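/- Let m ≥ 1, p = 41, p1 = 163, N = 163^m, and q = 41^{81·163^{m−1}}. Then for every k with 0 ≤ k ≤ 162, the Cayley graph Cay(F_q, D_k) is a strongly regular graph of degree (q−1)/163, where D_k = ∪_{i=0}^{163^{m−1}−1} C_{i + k·163^{m−1}}. -/

import Mathlib

open scoped Classical

noncomputable section

section StronglyRegular

variable {F R : Type*} [Field F] [Fintype F] [CommRing R] [IsDomain R]

/-- A function on a finite field whose Fourier coefficients at nonzero frequencies vanish is
constant. -/
theorem eq_of_sum_mul_addChar_eq_zero [CharZero R] {ψ : AddChar F R} (hψ : ψ.IsPrimitive)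
    (h : F → R) (hh : ∀ c ≠ 0, ∑ e, h e * ψ (c * e) = 0) (d b : F) : h d = h b := by
  have key : ∀ d, (Fintype.card F : R) * h d = ∑ e, h e := by
    intro d
    have h1 : ∑ c, ∑ e, h e * ψ (c * (e - d)) = (Fintype.card F : R) * h d := by
      rw [Finset.sum_comm]
      simp_rw [← Finset.mul_sum, AddChar.sum_mulShift _ hψ, sub_eq_zero]
      simp [mul_comm]
    rw [← h1, Finset.sum_eq_single 0]
    · simp
    · intro c _ hc
      have : ∀ e, h e * ψ (c * (e - d)) = h e * ψ (c * e) * ψ (-(c * d)) := by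
        intro e
        rw [mul_assoc, ← AddChar.map_add_eq_mul]
        ring_nf
      simp_rw [this]
      rw [← Finset.sum_mul, hh c hc, zero_mul]
    · simp
  have h2 : (Fintype.card F : R) ≠ 0 := by simp
  exact mul_left_cancel₀ h2 ((key d).trans (key b).symm)

/-- A Cayley graph on a finite field whose nonprincipal eigenvalues take at most two values is
strongly regular. -/
theorem exists_isSRGWith_of_sum_addChar [CharZero R] {ψ : AddChar F R} (hψ : ψ.IsPrimitive)
    (S : Finset F) (h0 : (0 : F) ∉ S) (hneg : ∀ x ∈ S, -x ∈ S) (α β : R)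
    (h : ∀ c ≠ 0, ∑ x ∈ S, ψ (c * x) = α ∨ ∑ x ∈ S, ψ (c * x) = β) :
    ∃ l u, (SimpleGraph.fromRel fun x y : F => x - y ∈ S).IsSRGWith
      (Fintype.card F) S.card l u := by
  set G := SimpleGraph.fromRel fun x y : F => x - y ∈ S with hG
  have hsub : ∀ x y : F, y - x ∈ S ↔ x - y ∈ S := fun x y =>
    ⟨fun hx => by simpa using hneg _ hx, fun hx => by simpa using hneg _ hx⟩
  have hadj : ∀ x y : F, G.Adj x y ↔ x - y ∈ S := by
    intro x y
    rw [hG, SimpleGraph.fromRel_adj, hsub x y, or_self, and_iff_right_iff_imp]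
    rintro hx rfl
    simp [h0] at hx
  let r : F → ℕ := fun d => (S.filter fun x => d - x ∈ S).card
  have hr : ∀ c, ∑ d, (r d : R) * ψ (c * d) = (∑ x ∈ S, ψ (c * x)) ^ 2 := by
    intro c
    have h1 : ∀ d, (r d : R) * ψ (c * d) =
        ∑ x ∈ S, if d - x ∈ S then ψ (c * x) * ψ (c * (d - x)) else 0 := by
      intro d
      rw [← Finset.sum_filter, ← nsmul_eq_mul, ← Finset.sum_const]
      refine Finset.sum_congr rfl fun x _ => ?_
      rw [← AddChar.map_add_eq_mul]
      ring_nf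
    simp_rw [h1]
    rw [Finset.sum_comm, sq, Finset.sum_mul]
    refine Finset.sum_congr rfl fun x _ => ?_
    rw [Finset.mul_sum, ← Finset.sum_filter]
    refine Finset.sum_bij' (fun d _ => d - x) (fun y _ => y + x) ?_ ?_ ?_ ?_ ?_ <;> simp
  have hconst : ∀ d d' : F, d ≠ 0 → d' ≠ 0 → (d ∈ S ↔ d' ∈ S) → r d = r d' := by
    intro d d' hd hd' hdd
    have := eq_of_sum_mul_addChar_eq_zero hψ
      (fun d => (r d : R) - (α + β) * (if d ∈ S then 1 else 0)
        + α * β * (if d = 0 then 1 else 0)) ?_ d d'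
    · simp only [hd, hd', hdd, if_false, mul_zero, add_zero, sub_left_inj, Nat.cast_inj] at this
      exact this
    · intro c hc
      simp only [sub_mul, add_mul _ _ (ψ _), Finset.sum_add_distrib, Finset.sum_sub_distrib, hr]
      simp only [mul_assoc, ← Finset.mul_sum, ite_mul, one_mul, zero_mul, Finset.sum_ite_mem,
        Finset.univ_inter, Finset.sum_ite_eq', Finset.mem_univ, if_true, mul_zero,
        AddChar.map_zero_eq_one]
      rcases h c hc with h | h <;> rw [h] <;> ring
  have hcommon : ∀ v w, Fintype.card (G.commonNeighbors v w) = r (v - w) := by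
    intro v w
    rw [← Set.toFinset_card]
    refine Finset.card_bij' (fun z _ => v - z) (fun x _ => v - x) ?_ ?_ ?_ ?_
    · intro z hz
      simp only [Set.mem_toFinset, SimpleGraph.mem_commonNeighbors, hadj] at hz
      simp only [Finset.mem_filter]
      refine ⟨hz.1, ?_⟩
      rw [show v - w - (v - z) = z - w by ring]
      exact (hsub w z).2 hz.2
    · intro x hx
      simp only [Finset.mem_filter] at hx
      simp only [Set.mem_toFinset, SimpleGraph.mem_commonNeighbors, hadj]
      refine ⟨by simpa using hx.1, (hsub w _).1 ?_⟩
      rw [show v - x - w = v - w - x by ring]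
      exact hx.2
    · simp
    · simp
  refine ⟨if hS : ∃ d, d ∈ S then r hS.choose else 0,
    if hS : ∃ d, d ≠ 0 ∧ d ∉ S then r hS.choose else 0, rfl, ?_, ?_, ?_⟩
  · intro v
    rw [← SimpleGraph.card_neighborFinset_eq_degree]
    refine Finset.card_bij' (fun z _ => v - z) (fun x _ => v - x) ?_ ?_ ?_ ?_
    · intro z hz
      rwa [SimpleGraph.mem_neighborFinset, hadj] at hz
    · intro x hx
      rw [SimpleGraph.mem_neighborFinset, hadj]
      simpa using hx
    · simp
    · simp
  · intro v w hvw
    rw [hadj] at hvw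
    have hS : ∃ d, d ∈ S := ⟨_, hvw⟩
    rw [hcommon, dif_pos hS]
    refine hconst _ _ ?_ ?_ (by simp [hvw, hS.choose_spec])
    · rintro h; exact h0 (h ▸ hvw)
    · intro h; exact h0 (h ▸ hS.choose_spec)
  · intro v w hvw hn
    rw [hadj] at hn
    have hS : ∃ d, d ≠ 0 ∧ d ∉ S := ⟨_, sub_ne_zero.2 hvw, hn⟩
    rw [hcommon, dif_pos hS]
    exact hconst _ _ (sub_ne_zero.2 hvw) hS.choose_spec.1 (by simp [hn, hS.choose_spec.2])

end StronglyRegular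

section Arithmetic

theorem sum_range_mul_eq {M : Type*} [AddCommMonoid M] (A B : ℕ) (f : ℕ → M) :
    ∑ n ∈ Finset.range (A * B), f n =
      ∑ a ∈ Finset.range A, ∑ b ∈ Finset.range B, f (a + A * b) := by
  induction B with
  | zero => simp
  | succ B ih =>
    rw [Nat.mul_succ, Finset.sum_range_add, ih]
    simp_rw [Finset.sum_range_succ, Finset.sum_add_distrib]
    congr 1
    exact Finset.sum_congr rfl fun a _ => by rw [add_comm]

theorem orderOf_fortyOne (n : ℕ) :
    orderOf (41 : ZMod (163 ^ (n + 1))) = 81 * 163 ^ n := by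
  have h1 : orderOf ((41 : ZMod (163 ^ (n + 1))) ^ 81) = 163 ^ n := by
    have := ZMod.orderOf_one_add_mul_prime (p := 163) (by norm_num) (by norm_num)
      ((41 ^ 81 - 1) / 163) (by norm_num) n
    rw [← this]
    congr 1
    have h : (41 : ℤ) ^ 81 = 1 + (163 : ℕ) * ((41 ^ 81 - 1) / 163) := by norm_num
    exact_mod_cast congrArg (Int.cast : ℤ → ZMod (163 ^ (n + 1))) h
  have h2 : 81 ∣ orderOf (41 : ZMod (163 ^ (n + 1))) := by
    have h3 : orderOf (41 : ZMod 163) = 81 := by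
      refine orderOf_eq_of_pow_and_pow_div_prime (by norm_num) (by decide +kernel) ?_
      intro p hp hd
      have : p = 3 := by
        have : p ∣ 3 ^ 4 := by simpa using hd
        exact (Nat.prime_dvd_prime_iff_eq hp Nat.prime_three).1 (hp.dvd_of_dvd_pow this)
      subst this
      decide +kernel
    have := orderOf_map_dvd (ZMod.castHom (dvd_pow_self 163 n.succ_ne_zero) (ZMod 163)).toMonoidHom
      (41 : ZMod (163 ^ (n + 1)))
    have h4 : (ZMod.castHom (dvd_pow_self 163 n.succ_ne_zero) (ZMod 163)).toMonoidHom
      (41 : ZMod (163 ^ (n + 1))) = 41 := map_ofNat (ZMod.castHom _ (ZMod 163)) 41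
    rwa [h4, h3] at this
  rw [orderOf_pow_of_dvd (by norm_num) h2] at h1
  rw [← h1, Nat.mul_div_cancel' h2]

/-- The powers of `41` modulo `163 ^ (n + 1)` are the quadratic residues. -/
theorem exists_fortyOne_pow_eq (n u : ℕ) (hu : u ^ 81 ≡ 1 [MOD 163]) :
    ∃ k, 41 ^ k ≡ u [MOD 163 ^ (n + 1)] := by
  have : Fact (Nat.Prime 163) := ⟨by norm_num⟩
  have hu1 : (u : ZMod (163 ^ (n + 1))) ^ (81 * 163 ^ n) = 1 := by
    have h1 : ((163 : ℕ) : ℤ) ∣ (u : ℤ) ^ 81 - 1 := by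
      have := (Nat.modEq_iff_dvd.1 hu.symm)
      exact_mod_cast this
    have h2 := dvd_sub_pow_of_dvd_sub h1 n
    have h3 : (((u : ℤ) ^ 81) ^ 163 ^ n : ℤ) ≡ 1 ^ 163 ^ n [ZMOD (163 ^ (n + 1) : ℕ)] :=
      (Int.modEq_iff_dvd.2 (by exact_mod_cast h2)).symm
    have h4 := (ZMod.intCast_eq_intCast_iff _ _ _).2 h3
    rw [pow_mul]
    push_cast at h4
    rw [one_pow] at h4
    exact h4
  have := ZMod.isCyclic_units_of_prime_pow 163 (by norm_num) (by norm_num) (n + 1)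
  have hpos : 0 < 81 * 163 ^ n := by positivity
  set U : (ZMod (163 ^ (n + 1)))ˣ := Units.ofPowEqOne _ _ hu1 hpos.ne'
  have hp1 : (41 : ZMod (163 ^ (n + 1))) ^ (81 * 163 ^ n) = 1 := by
    rw [← orderOf_fortyOne]
    exact pow_orderOf_eq_one _
  set p : (ZMod (163 ^ (n + 1)))ˣ := Units.ofPowEqOne _ _ hp1 hpos.ne' with hp
  have hord : orderOf p = 81 * 163 ^ n := by
    rw [← orderOf_units, ← orderOf_fortyOne]; rfl
  have hsub : (Finset.range (orderOf p)).image (p ^ ·) ⊆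
      Finset.univ.filter fun v => v ^ (81 * 163 ^ n) = 1 := by
    intro v hv
    simp only [Finset.mem_image] at hv
    obtain ⟨k, -, rfl⟩ := hv
    simp only [Finset.mem_filter, Finset.mem_univ, true_and]
    rw [← hord, ← pow_mul, mul_comm, pow_mul, pow_orderOf_eq_one, one_pow]
  have heq := Finset.eq_of_subset_of_card_le hsub (by
    rw [Finset.card_image_of_injOn, Finset.card_range, hord]
    · exact IsCyclic.card_pow_eq_one_le hpos
    · intro i hi j hj hij
      exact pow_injOn_Iio_orderOf (by simpa using hi) (by simpa using hj) hij)
  have hU : U ∈ Finset.univ.filter fun v => v ^ (81 * 163 ^ n) = 1 := by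
    simp only [Finset.mem_filter, Finset.mem_univ, true_and]
    exact Units.pow_ofPowEqOne hu1 hpos.ne'
  rw [← heq] at hU
  obtain ⟨k, -, hk⟩ := Finset.mem_image.1 hU
  refine ⟨k, (ZMod.natCast_eq_natCast_iff _ _ _).1 ?_⟩
  have := congrArg (Units.val) hk
  push_cast
  exact this

section Invariant

variable {X : Type*} {n : ℕ} {f : ℕ → X} (hN : ∀ a, f (a + 163 ^ (n + 1)) = f a)
  (hp : ∀ a, f (41 * a) = f a)

include hN in
theorem eq_of_modEq_of_periodic {a b : ℕ} (hab : a ≡ b [MOD 163 ^ (n + 1)]) : f a = f b := by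
  have hper : Function.Periodic f (163 ^ (n + 1)) := hN
  rw [← hper.map_mod_nat a, ← hper.map_mod_nat b, hab]

include hN hp in
theorem eq_of_mul_modEq {a b u : ℕ} (hu : u ^ 81 ≡ 1 [MOD 163])
    (hab : u * a ≡ b [MOD 163 ^ (n + 1)]) : f a = f b := by
  obtain ⟨k, hk⟩ := exists_fortyOne_pow_eq n u hu
  have h1 : ∀ k, f (41 ^ k * a) = f a := by
    intro k
    induction k with
    | zero => simp
    | succ k ih => rw [pow_succ', mul_assoc, hp, ih]
  rw [← h1 k]
  exact eq_of_modEq_of_periodic hN ((hk.mul_right a).trans hab)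

include hN hp in
theorem eq_add_of_not_dvd {a : ℕ} (ha : ¬ 163 ^ n ∣ a) : f (a + 163 ^ n) = f a := by
  have h163 : Nat.Prime 163 := by norm_num
  have ha0 : a ≠ 0 := by rintro rfl; simp at ha
  obtain ⟨v, a', ha', rfl⟩ := Nat.exists_eq_pow_mul_and_not_dvd ha0 163 (by norm_num)
  have hv : v < n := by
    by_contra! h
    exact ha ((pow_dvd_pow _ h).mul_right _)
  obtain ⟨w, rfl⟩ := Nat.exists_eq_add_of_lt hv
  obtain ⟨t, ht⟩ := Nat.exists_mul_mod_eq_one_of_coprime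
    ((Nat.Prime.coprime_iff_not_dvd h163).2 ha').symm (by norm_num)
  have ht' : a' * t ≡ 1 [MOD 163] := ht.2
  refine (eq_of_mul_modEq hN hp (u := 1 + 163 ^ (w + 1) * t) ?_ ?_).symm
  · have : 1 + 163 ^ (w + 1) * t ≡ 1 + 0 [MOD 163] :=
      Nat.ModEq.add_left _ (Nat.modEq_zero_iff_dvd.2 ((dvd_pow_self _ w.succ_ne_zero).mul_right _))
    simpa using this.pow 81
  · rw [show (1 + 163 ^ (w + 1) * t) * (163 ^ v * a') =
      163 ^ v * a' + 163 ^ (v + w + 1) * (a' * t) by ring]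
    have := (Nat.ModEq.mul_left' (163 ^ (v + w + 1)) ht').add_left (163 ^ v * a')
    rwa [mul_one] at this

include hN hp in
theorem eq_of_pow_modEq {y z : ℕ} (hy : ¬ 163 ∣ y) (hyz : y ^ 81 ≡ z ^ 81 [MOD 163]) :
    f (163 ^ n * y) = f (163 ^ n * z) := by
  have h163 : Nat.Prime 163 := by norm_num
  have hcop := ((Nat.Prime.coprime_iff_not_dvd h163).2 hy).symm
  obtain ⟨t, ht⟩ := Nat.exists_mul_mod_eq_one_of_coprime hcop (by norm_num)
  have ht' : y * t ≡ 1 [MOD 163] := ht.2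
  refine eq_of_mul_modEq hN hp (u := t * z) ?_ ?_
  · rw [mul_pow]
    refine (hyz.symm.mul_left _).trans ?_
    rw [← mul_pow, mul_comm]
    simpa using ht'.pow 81
  · rw [show t * z * (163 ^ n * y) = 163 ^ n * (y * t * z) by ring, pow_succ]
    have := (ht'.mul_right z).mul_left' (163 ^ n)
    rwa [one_mul] at this

theorem pow_eightyOne_mod (y : ℕ) (hy : ¬ 163 ∣ y) : y ^ 81 % 163 = 1 ∨ y ^ 81 % 163 = 162 := by
  have h : ∀ r < 163, r ≠ 0 → r ^ 81 % 163 = 1 ∨ r ^ 81 % 163 = 162 := by decide +kernel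
  rw [Nat.pow_mod]
  exact h _ (Nat.mod_lt _ (by norm_num)) (fun h => hy (Nat.dvd_of_mod_eq_zero h))

end Invariant

/-- A sum over a full window differs from the sum over the initial one by a single term. -/
theorem exists_sum_window {M : Type*} [AddCommGroup M] {n : ℕ} {f : ℕ → M}
    (hN : ∀ a, f (a + 163 ^ (n + 1)) = f a) (hp : ∀ a, f (41 * a) = f a) (b : ℕ) :
    ∃ y, b ≤ 163 ^ n * y ∧ 163 ^ n * y < b + 163 ^ n ∧
      ∑ i ∈ Finset.range (163 ^ n), f (b + i) =
        ∑ i ∈ Finset.range (163 ^ n), f i - f 0 + f (163 ^ n * y) := by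
  induction b with
  | zero => exact ⟨0, by simp, by simp, by simp⟩
  | succ b ih =>
    obtain ⟨y, h1, h2, h3⟩ := ih
    have hstep : ∑ i ∈ Finset.range (163 ^ n), f (b + 1 + i) =
        ∑ i ∈ Finset.range (163 ^ n), f (b + i) + f (b + 163 ^ n) - f b := by
      rw [← Finset.sum_range_succ (fun i => f (b + i)), Finset.sum_range_succ']
      simp [add_assoc, add_comm 1]
    by_cases hb : 163 ^ n ∣ b
    · obtain ⟨z, rfl⟩ := hb
      have hy : y = z := by
        have h4 := Nat.le_of_mul_le_mul_left h1 (by positivity)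
        have h5 : 163 ^ n * y < 163 ^ n * (z + 1) := by rw [mul_add_one]; exact h2
        have := Nat.lt_of_mul_lt_mul_left h5
        omega
      subst hy
      refine ⟨y + 1, ?_, ?_, ?_⟩
      · rw [mul_add_one]; have : 0 < 163 ^ n := by positivity
        omega
      · rw [mul_add_one]; omega
      · rw [hstep, h3, mul_add_one]; abel
    · refine ⟨y, ?_, by omega, ?_⟩
      · rcases h1.lt_or_eq with h | h
        · exact h
        · exact absurd ⟨y, h⟩ hb
      · rw [hstep, h3, eq_add_of_not_dvd hN hp hb]; abel

theorem two_mul_sum_range_filter (n c : ℕ) (hc : c = 1 ∨ c = 162) :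
    2 * ∑ r ∈ (Finset.range (163 ^ (n + 1))).filter (fun r => r ^ 81 % 163 = c), r ≤
      163 ^ (n + 1) * (81 * 163 ^ n + 1) := by
  rw [Finset.sum_filter, pow_succ', sum_range_mul_eq]
  have hmod : ∀ a b, (a + 163 * b) ^ 81 % 163 = a ^ 81 % 163 := by
    intro a b
    rw [Nat.pow_mod, Nat.add_mul_mod_self_left, ← Nat.pow_mod]
  simp_rw [hmod]
  set P := 163 ^ n
  have hP : 0 < P := by positivity
  have hin : ∀ a, 2 * ∑ b ∈ Finset.range P, (if a ^ 81 % 163 = c then a + 163 * b else 0) =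
      if a ^ 81 % 163 = c then 2 * P * a + 163 * (P * (P - 1)) else 0 := by
    intro a
    split_ifs
    · rw [Finset.sum_add_distrib, ← Finset.mul_sum, mul_add, ← Finset.sum_range_id_mul_two]
      simp
      ring
    · simp
  rw [Finset.mul_sum]
  simp_rw [hin]
  rw [← Finset.sum_filter, Finset.sum_add_distrib, ← Finset.mul_sum, Finset.sum_const]
  have h1 : ∑ a ∈ (Finset.range 163).filter (fun a => a ^ 81 % 163 = c), a ≤ 163 * 41 := by
    rcases hc with rfl | rfl <;> decide +kernel
  have h2 : ((Finset.range 163).filter (fun a => a ^ 81 % 163 = c)).card = 81 := by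
    rcases hc with rfl | rfl <;> decide +kernel
  rw [h2]
  obtain ⟨k, hk⟩ : ∃ k, P = k + 1 := ⟨P - 1, by omega⟩
  rw [hk, Nat.add_sub_cancel, smul_eq_mul]
  nlinarith [Nat.mul_le_mul_left (2 * (k + 1)) h1]

theorem forty_mul_sum_le (n c j : ℕ) (hc : c = 1 ∨ c = 162) (hj : j ^ 81 % 163 = c) :
    ∑ i ∈ Finset.range (81 * 163 ^ n), 41 * (41 ^ i * j % 163 ^ (n + 1)) / 163 ^ (n + 1) ≤
      20 * (81 * 163 ^ n + 1) := by
  set N := 163 ^ (n + 1) with hN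
  have hNpos : 0 < N := by positivity
  have h163 : Nat.Prime 163 := by norm_num
  have hjc : Nat.Coprime N j := by
    refine Nat.Coprime.pow_left _ ((Nat.Prime.coprime_iff_not_dvd h163).2 fun h => ?_)
    rw [Nat.pow_mod, Nat.mod_eq_zero_of_dvd h] at hj
    simp at hj
    omega
  set ρ : ℕ → ℕ := fun i => 41 ^ i * j % N with hρ
  have hinj : Set.InjOn ρ (Finset.range (81 * 163 ^ n)) := by
    intro a ha b hb hab
    have h1 : 41 ^ a * j ≡ 41 ^ b * j [MOD N] := hab
    have h2 := Nat.ModEq.cancel_right_of_coprime hjc h1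
    rw [← orderOf_fortyOne] at ha hb
    refine pow_injOn_Iio_orderOf (by simpa using ha) (by simpa using hb) ?_
    have := (ZMod.natCast_eq_natCast_iff _ _ _).2 h2
    push_cast at this
    exact this
  have hsum : 2 * ∑ i ∈ Finset.range (81 * 163 ^ n), ρ i ≤ N * (81 * 163 ^ n + 1) := by
    rw [← Finset.sum_image (f := fun r => r) hinj]
    refine le_trans (Nat.mul_le_mul_left 2 ?_) (two_mul_sum_range_filter n c hc)
    refine Finset.sum_le_sum_of_subset fun r hr => ?_
    obtain ⟨i, -, rfl⟩ := Finset.mem_image.1 hr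
    simp only [Finset.mem_filter, Finset.mem_range]
    refine ⟨Nat.mod_lt _ hNpos, ?_⟩
    have h1 : ρ i ≡ 41 ^ i * j [MOD 163] :=
      (Nat.mod_modEq _ N).of_dvd (dvd_pow_self _ n.succ_ne_zero)
    have h2 : (ρ i) ^ 81 ≡ j ^ 81 [MOD 163] := by
      refine (h1.pow 81).trans ?_
      rw [mul_pow, ← pow_mul, mul_comm i, pow_mul]
      have : 41 ^ 81 ≡ 1 [MOD 163] := by decide +kernel
      simpa using (this.pow i).mul_right (j ^ 81)
    rw [← hj]
    exact h2
  have htel : ∀ k, N * ∑ i ∈ Finset.range k, 41 * ρ i / N + ρ k =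
      40 * ∑ i ∈ Finset.range k, ρ i + ρ 0 := by
    intro k
    induction k with
    | zero => simp
    | succ k ih =>
      rw [Finset.sum_range_succ, Finset.sum_range_succ]
      have h1 : ρ (k + 1) = 41 * ρ k % N := by
        simp only [hρ]
        rw [Nat.mul_mod_mod, pow_succ']
        ring_nf
      have h2 := Nat.div_add_mod (41 * ρ k) N
      rw [h1]
      nlinarith
  have hend : ρ (81 * 163 ^ n) = ρ 0 := by
    have h1 : 41 ^ (81 * 163 ^ n) ≡ 1 [MOD N] := by
      refine (ZMod.natCast_eq_natCast_iff _ _ _).1 ?_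
      push_cast
      rw [← orderOf_fortyOne]
      exact pow_orderOf_eq_one _
    simp only [hρ]
    rw [pow_zero]
    exact h1.mul_right j
  have := htel (81 * 163 ^ n)
  rw [hend] at this
  refine le_of_mul_le_mul_left (a := N) ?_ hNpos
  change N * ∑ i ∈ Finset.range (81 * 163 ^ n), 41 * ρ i / N ≤ _
  nlinarith

end Arithmetic

section GaussSum

theorem sum_units_eq_sub {K M : Type*} [Field K] [Fintype K] [DecidableEq K]
    [AddCommGroup M] (g : K → M) :
    ∑ u : Kˣ, g u = ∑ x, g x - g 0 := by
  rw [← Finset.sum_erase_eq_sub (Finset.mem_univ 0)]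
  refine Finset.sum_bij (fun (x : Kˣ) _ => (x : K)) (by simp)
    (fun a _ b _ h => Units.ext h) (fun b hb => ?_) (by simp)
  exact ⟨Units.mk0 b (by simpa using hb), by simp, rfl⟩

variable {p : ℕ} [Fact p.Prime] {F R : Type*} [Field F] [Fintype F] [CharP F p]
  [Algebra (ZMod p) F] [CommRing R]

/-- The Teichmüller character of `F` with values in a ring over the Witt vectors of `F`. -/
def teichmullerChar (τ : WittVector p F →+* R) : MulChar F R where
  toFun x := τ (WittVector.teichmuller p x)
  map_one' := by simp
  map_mul' := by simp
  map_nonunit' x hx := by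
    rw [isUnit_iff_ne_zero, not_not] at hx
    simp [hx]

omit [Fintype F] [CharP F p] [Algebra (ZMod p) F] in
theorem teichmullerChar_apply (τ : WittVector p F →+* R) (x : F) :
    teichmullerChar τ x = τ (WittVector.teichmuller p x) := rfl

omit [Fintype F] [Algebra (ZMod p) F] in
theorem teichmullerChar_apply_ne_one [Nontrivial R] (τ : WittVector p F →+* R) {x : F}
    (hx : x ≠ 1) : teichmullerChar τ x ≠ 1 := by
  intro h
  have h1 : IsUnit (WittVector.teichmuller p x - 1) := by
    refine WittVector.isUnit_of_coeff_zero_ne_zero _ ?_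
    change (WittVector.constantCoeff : WittVector p F →+* F) (WittVector.teichmuller p x - 1) ≠ 0
    have h2 : (WittVector.constantCoeff : WittVector p F →+* F) (WittVector.teichmuller p x) = x :=
      WittVector.teichmuller_coeff_zero p x
    rw [map_sub, map_one, h2]
    exact sub_ne_zero.2 hx
  have h3 := h1.map τ
  rw [map_sub, ← teichmullerChar_apply, h, map_one, sub_self] at h3
  exact not_isUnit_zero h3

omit [Fintype F] [Algebra (ZMod p) F] in
theorem isPrimitiveRoot_teichmullerChar_apply [Nontrivial R] (τ : WittVector p F →+* R) (u : Fˣ) :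
    IsPrimitiveRoot (teichmullerChar τ u) (orderOf u) where
  pow_eq_one := by
    rw [← map_pow, ← Units.val_pow_eq_pow_val, pow_orderOf_eq_one, Units.val_one, map_one]
  dvd_of_pow_eq_one l hl := by
    refine orderOf_dvd_of_pow_eq_one ?_
    by_contra h
    refine teichmullerChar_apply_ne_one τ (x := (u : F) ^ l) ?_ (by rw [map_pow, hl])
    rwa [← Units.val_pow_eq_pow_val, Ne, Units.val_eq_one]

variable (F) in
/-- The additive character `x ↦ ζ ^ Tr x` of `F`. -/
def traceChar {ζ : R} (hζ : ζ ^ p = 1) : AddChar F R :=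
  (AddChar.zmodChar p hζ).compAddMonoidHom (Algebra.trace (ZMod p) F).toAddMonoidHom

omit [Fintype F] [CharP F p] in
theorem traceChar_apply {ζ : R} (hζ : ζ ^ p = 1) (x : F) :
    traceChar F hζ x = ζ ^ (Algebra.trace (ZMod p) F x).val := rfl

omit [CharP F p] in
theorem traceChar_ne_one {ζ : R} (hζ : IsPrimitiveRoot ζ p) :
    traceChar F hζ.pow_eq_one ≠ 1 := by
  intro h
  obtain ⟨x, hx⟩ := Algebra.trace_surjective (ZMod p) F 1
  have h1 := DFunLike.congr_fun h x
  have : Fact (1 < p) := ⟨(Fact.out : p.Prime).one_lt⟩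
  rw [traceChar_apply, hx, ZMod.val_one, pow_one, AddChar.one_apply] at h1
  exact hζ.ne_one (Fact.out : p.Prime).one_lt h1

omit [CharP F p] in
theorem traceChar_isPrimitive {ζ : R} (hζ : IsPrimitiveRoot ζ p) :
    (traceChar F hζ.pow_eq_one).IsPrimitive :=
  AddChar.IsPrimitive.of_ne_one (traceChar_ne_one hζ)

omit [CharP F p] in
theorem traceChar_pow {ζ : R} (hζ : ζ ^ p = 1) (x : F) :
    traceChar F hζ (x ^ p) = traceChar F hζ x := by
  rw [traceChar_apply, traceChar_apply]
  have := Algebra.trace_eq_of_algEquiv (FiniteField.frobeniusAlgEquivOfAlgebraic (ZMod p) F) x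
  rw [FiniteField.coe_frobeniusAlgEquivOfAlgebraic, ZMod.card] at this
  rw [this]

theorem gaussSum_pow_char {ζ : R} (hζ : ζ ^ p = 1) (χ : MulChar F R) :
    gaussSum (χ ^ p) (traceChar F hζ) = gaussSum χ (traceChar F hζ) := by
  have hp : p ≠ 0 := (Fact.out : p.Prime).ne_zero
  rw [gaussSum, gaussSum]
  refine Fintype.sum_bijective (fun x : F => x ^ p) ?_ _ _ fun x => ?_
  · exact (Finite.injective_iff_bijective).1 (frobenius_inj F p)
  · rw [MulChar.pow_apply' _ hp, map_pow, traceChar_pow]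

theorem sub_one_pow_dvd [IsDomain R] {ζ : R} (hζ : IsPrimitiveRoot ζ p) :
    (ζ - 1) ^ (p - 1) ∣ (p : R) := by
  have hp : p.Prime := Fact.out
  have h1 := Polynomial.eval_one_cyclotomic_prime (R := R) (p := p)
  rw [Polynomial.cyclotomic_eq_prod_X_sub_primitiveRoots hζ, Polynomial.eval_prod] at h1
  have hcard : (primitiveRoots p R).card = p - 1 := by
    rw [hζ.card_primitiveRoots, Nat.totient_prime hp]
  rw [← h1, ← hcard, ← Finset.prod_const]
  refine Finset.prod_dvd_prod_of_dvd _ _ fun μ hμ => ?_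
  have hμ' := isPrimitiveRoot_of_mem_primitiveRoots hμ
  obtain ⟨i, -, rfl⟩ := hζ.eq_pow_of_pow_eq_one hμ'.pow_eq_one
  rw [Polynomial.eval_sub, Polynomial.eval_X, Polynomial.eval_C, ← dvd_neg, neg_sub]
  simpa using sub_dvd_pow_sub_pow ζ 1 i

theorem sub_one_not_isUnit [IsDomain R] [IsLocalRing R] {ζ : R} (hζ : ζ ^ p = 1)
    (hp : ¬ IsUnit (p : R)) : ¬ IsUnit (ζ - 1) := by
  intro h
  have hres : (p : IsLocalRing.ResidueField R) = 0 := by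
    rw [← map_natCast (IsLocalRing.residue R), IsLocalRing.residue_eq_zero_iff]
    exact hp
  have : CharP (IsLocalRing.ResidueField R) p :=
    ringChar.of_eq (CharP.ringChar_of_prime_eq_zero Fact.out hres)
  have h1 : (IsLocalRing.residue R (ζ - 1)) ^ p = 0 := by
    rw [map_sub, map_one, sub_pow_char, one_pow, ← map_pow, hζ, map_one, sub_self]
  have h2 := (h.map (IsLocalRing.residue R)).pow p
  rw [h1] at h2
  exact not_isUnit_zero h2

omit [CharP F p] in
theorem sum_inv_mul_trace :
    ∑ x : F, x⁻¹ * algebraMap (ZMod p) F (Algebra.trace (ZMod p) F x) = -1 := by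
  have hp : p.Prime := Fact.out
  have hcard : Fintype.card F = p ^ Module.finrank (ZMod p) F := by
    rw [Module.card_eq_pow_finrank (K := ZMod p), ZMod.card]
  set f := Module.finrank (ZMod p) F
  have hf : 0 < f := Module.finrank_pos
  simp_rw [FiniteField.algebraMap_trace_eq_sum_pow, Finset.mul_sum]
  rw [Finset.sum_comm]
  have hin : ∀ i ∈ Finset.range f, ∑ x : F, x⁻¹ * x ^ Nat.card (ZMod p) ^ i =
      if i = 0 then -1 else 0 := by
    intro i hi
    rw [Nat.card_zmod]
    have hpi : 0 < p ^ i := pow_pos hp.pos i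
    have h1 : ∑ x : F, x⁻¹ * x ^ p ^ i = ∑ x : Fˣ, (x ^ (p ^ i - 1) : F) := by
      have h2 := sum_units_eq_sub fun x : F => x⁻¹ * x ^ p ^ i
      rw [inv_zero, zero_mul, sub_zero] at h2
      rw [← h2]
      refine Finset.sum_congr rfl fun x _ => ?_
      rw [← Nat.succ_pred_eq_of_pos hpi, pow_succ', inv_mul_cancel_left₀ x.ne_zero]
      simp
    rw [h1, FiniteField.sum_pow_units, hcard]
    congr 1
    refine propext ⟨fun hd => ?_, fun h => by simp [h]⟩
    by_contra h0
    have hlt : p ^ i < p ^ f := Nat.pow_lt_pow_right hp.one_lt (Finset.mem_range.1 hi)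
    have h2 : 1 < p ^ i := Nat.one_lt_pow h0 hp.one_lt
    have := Nat.le_of_dvd (by omega) hd
    omega
  rw [Finset.sum_congr rfl hin, Finset.sum_ite_eq' _ 0]
  simp [hf]

theorem gaussSum_teichmullerChar_inv_dvd [IsDomain R] [IsLocalRing R]
    (τ : WittVector p F →+* R) (hcard : 2 < Fintype.card F) {ζ : R} (hζ : IsPrimitiveRoot ζ p)
    (hp : ¬ IsUnit (p : R)) :
    gaussSum (teichmullerChar τ)⁻¹ (traceChar F hζ.pow_eq_one) ∣ ζ - 1 := by
  set ω := teichmullerChar τ with hω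
  set t : F → ℕ := fun x => (Algebra.trace (ZMod p) F x).val with ht
  have hgeom : ∀ n : ℕ, ∃ w : R, ζ ^ n = 1 + (ζ - 1) * (n + (ζ - 1) * w) := by
    intro n
    induction n with
    | zero => exact ⟨0, by simp⟩
    | succ n ih =>
      obtain ⟨w, hw⟩ := ih
      refine ⟨n + ζ * w, ?_⟩
      rw [pow_succ, hw]
      push_cast
      ring
  choose w hw using hgeom
  set u : WittVector p F := ∑ x : F, WittVector.teichmuller p x⁻¹ * (t x : WittVector p F) with hu
  have hu_unit : IsUnit u := by
    refine WittVector.isUnit_of_coeff_zero_ne_zero u ?_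
    have h1 : (WittVector.constantCoeff : WittVector p F →+* F) u = -1 := by
      rw [hu, map_sum, ← sum_inv_mul_trace (p := p)]
      refine Finset.sum_congr rfl fun x _ => ?_
      rw [map_mul, map_natCast]
      refine congrArg₂ _ (WittVector.teichmuller_coeff_zero p x⁻¹) ?_
      · simp only [ht]
        rw [← map_natCast (algebraMap (ZMod p) F), ZMod.natCast_zmod_val]
    change (WittVector.constantCoeff : WittVector p F →+* F) u ≠ 0
    rw [h1]
    simp
  have hne : ω⁻¹ ≠ 1 := by
    intro h
    obtain ⟨x, hx0, hx1⟩ : ∃ x : F, x ≠ 0 ∧ x ≠ 1 := by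
      by_contra! hcon
      have : Fintype.card F ≤ 2 := by
        rw [← Finset.card_univ]
        refine (Finset.card_le_card (t := {0, 1}) fun x _ => ?_).trans Finset.card_le_two
        by_cases hx : x = 0
        · simp [hx]
        · simp [hcon x hx]
      omega
    have h1 : ω = 1 := by rwa [inv_eq_one] at h
    refine teichmullerChar_apply_ne_one τ hx1 ?_
    rw [← hω, h1, MulChar.one_apply (isUnit_iff_ne_zero.2 hx0)]
  have hg : gaussSum ω⁻¹ (traceChar F hζ.pow_eq_one) =
      (ζ - 1) * (τ u + (ζ - 1) * ∑ x, ω⁻¹ x * w (t x)) := by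
    rw [gaussSum]
    have h1 : ∀ x, ω⁻¹ x * traceChar F hζ.pow_eq_one x =
        ω⁻¹ x + (ζ - 1) * (τ (WittVector.teichmuller p x⁻¹ * (t x : WittVector p F))
          + (ζ - 1) * (ω⁻¹ x * w (t x))) := by
      intro x
      rw [traceChar_apply, hw, map_mul, map_natCast, ← teichmullerChar_apply, ← hω,
        ← MulChar.inv_apply']
      ring
    simp_rw [h1]
    rw [Finset.sum_add_distrib, MulChar.sum_eq_zero_of_ne_one hne, zero_add, ← Finset.mul_sum,
      Finset.sum_add_distrib, ← Finset.mul_sum, hu, map_sum]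
  have hunit : IsUnit (τ u + (ζ - 1) * ∑ x, ω⁻¹ x * w (t x)) := by
    by_contra hcon
    have h1 : (ζ - 1) * ∑ x, ω⁻¹ x * w (t x) ∈ nonunits R :=
      mul_mem_nonunits_left (sub_one_not_isUnit hζ.pow_eq_one hp)
    have h2 := IsLocalRing.nonunits_add hcon (b := -((ζ - 1) * ∑ x, ω⁻¹ x * w (t x)))
      (by simpa [mem_nonunits_iff] using h1)
    rw [add_neg_cancel_right] at h2
    exact h2 (hu_unit.map τ)
  rw [hg, hunit.mul_right_dvd]

theorem gaussSum_mul_dvd [IsDomain R] {ψ : AddChar F R} (hψ : ψ ≠ 1) {χ φ : MulChar F R} {a b : R}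
    (hχ : gaussSum χ ψ ∣ a) (hφ : gaussSum φ ψ ∣ b) : gaussSum (χ * φ) ψ ∣ a * b := by
  by_cases h : χ * φ = 1
  · rw [h, gaussSum_one_left hψ]
    exact (isUnit_one.neg).dvd
  · exact (Dvd.intro _ (jacobiSum_mul_nontrivial h ψ)).trans (mul_dvd_mul hχ hφ)

theorem gaussSum_pow_dvd [IsDomain R] {ψ : AddChar F R} (hψ : ψ ≠ 1) {χ : MulChar F R} {a : R}
    (hχ : gaussSum χ ψ ∣ a) (n : ℕ) : gaussSum (χ ^ n) ψ ∣ a ^ n := by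
  induction n with
  | zero => rw [pow_zero, gaussSum_one_left hψ]; exact (isUnit_one.neg).dvd
  | succ n ih => rw [pow_succ, pow_succ]; exact gaussSum_mul_dvd hψ ih hχ

/-- The easy half of Stickelberger's theorem, with the digits of `⌊p ^ k * j / N⌋` in base `p`
written as quotients by `N`. -/
theorem gaussSum_inv_pow_dvd [IsDomain R] {ζ : R} (hζ : IsPrimitiveRoot ζ p)
    {χ : MulChar F R} (hχ : gaussSum χ (traceChar F hζ.pow_eq_one) ∣ ζ - 1)
    {N j : ℕ} (hj : j < N) (k : ℕ) :
    gaussSum (χ ^ (p ^ k * j / N)) (traceChar F hζ.pow_eq_one) ∣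
      (ζ - 1) ^ ∑ i ∈ Finset.range k, p * (p ^ i * j % N) / N := by
  have hψ := traceChar_ne_one (F := F) hζ
  have hN : 0 < N := by omega
  induction k with
  | zero =>
    rw [pow_zero, one_mul, Nat.div_eq_of_lt hj, pow_zero, gaussSum_one_left hψ]
    exact (isUnit_one.neg).dvd
  | succ k ih =>
    have h1 : p ^ (k + 1) * j / N = p ^ k * j / N * p + p * (p ^ k * j % N) / N := by
      conv_lhs => rw [pow_succ', mul_assoc, ← Nat.div_add_mod (p ^ k * j) N, mul_add,
        show p * (N * (p ^ k * j / N)) = N * (p ^ k * j / N * p) by ring,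
        Nat.mul_add_div hN]
    rw [h1, pow_add, Finset.sum_range_succ, pow_add, pow_mul]
    refine gaussSum_mul_dvd hψ ?_ (gaussSum_pow_dvd hψ hχ _)
    rw [gaussSum_pow_char]
    exact ih

end GaussSum

theorem WittVector.charZero (p : ℕ) [Fact p.Prime] (F : Type*) [Field F] [CharP F p] :
    CharZero (WittVector p F) := by
  have h := CharP.exists (WittVector p F)
  obtain ⟨r, hr⟩ := h
  rcases CharP.char_is_prime_or_zero (WittVector p F) r with h0 | h0
  · have h1 : (r : F) = 0 := by
      rw [← map_natCast (WittVector.constantCoeff : WittVector p F →+* F), CharP.cast_eq_zero,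
        map_zero]
    have h2 : p = r := (Nat.prime_dvd_prime_iff_eq Fact.out h0).1 ((CharP.cast_eq_zero_iff F p r).1 h1)
    subst h2
    exact absurd (CharP.cast_eq_zero _ _) (WittVector.p_nonzero p F)
  · subst h0
    exact CharP.charP_to_charZero _

/-- There is a valuation ring of characteristic zero dominating the Witt vectors of `F` and
containing a primitive `p`-th root of unity. -/
theorem exists_isLocalRing_wittVector (p : ℕ) [Fact p.Prime] (F : Type) [Field F]
    [CharP F p] [PerfectRing F p] :
    ∃ (R : Type) (_ : CommRing R) (_ : IsDomain R) (_ : IsLocalRing R) (_ : CharZero R)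
      (_ : WittVector p F →+* R) (ζ : R), IsPrimitiveRoot ζ p ∧ ¬ IsUnit (p : R) := by
  have := WittVector.charZero p F
  let K := FractionRing (WittVector p F)
  let L := AlgebraicClosure K
  have hK : CharZero K := charZero_of_injective_algebraMap
    (IsFractionRing.injective (WittVector p F) K)
  have hL : CharZero L := charZero_of_injective_algebraMap (algebraMap K L).injective
  let g : WittVector p F →+* L := (algebraMap K L).comp (algebraMap (WittVector p F) K)
  have hg : Function.Injective g :=
    (algebraMap K L).injective.comp (IsFractionRing.injective (WittVector p F) K)
  let e := RingEquiv.ofBijective g.rangeRestrict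
    ⟨fun a b h => hg (congrArg Subtype.val h), g.rangeRestrict_surjective⟩
  have hI : Ideal.span {(p : g.range)} ≠ ⊤ := by
    rw [Ne, Ideal.span_singleton_eq_top]
    intro h
    have h1 := h.map e.symm
    rw [map_natCast] at h1
    exact (WittVector.irreducible p (k := F)).not_isUnit h1
  obtain ⟨V, hV, hV'⟩ := Ideal.image_subset_nonunits_valuationSubring _ hI
  have : NeZero (p : L) := ⟨by exact_mod_cast (Fact.out : p.Prime).ne_zero⟩
  obtain ⟨ζ, hζ⟩ := HasEnoughRootsOfUnity.exists_primitiveRoot L p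
  have hζV : ζ ∈ V := by
    rcases V.mem_or_inv_mem ζ with h | h
    · exact h
    · have h1 : ζ = ζ⁻¹ ^ (p - 1) := by
        have hp : p - 1 + 1 = p := Nat.sub_add_cancel (Fact.out : p.Prime).one_le
        rw [inv_pow]
        refine eq_inv_of_mul_eq_one_left ?_
        rw [← pow_succ', hp, hζ.pow_eq_one]
      rw [h1]
      exact pow_mem h _
  refine ⟨V, inferInstance, inferInstance, inferInstance,
    ⟨fun a b h => ?_⟩, (Subring.inclusion hV).comp g.rangeRestrict, ⟨ζ, hζV⟩, ?_, ?_⟩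
  · exact Nat.cast_injective (R := L) (by simpa using congrArg (Subtype.val) h)
  · exact IsPrimitiveRoot.of_map_of_injective (f := V.subtype) (by simpa using hζ) V.subtype_injective
  · have h1 : (p : L) ∈ V.nonunits := hV' ⟨(p : g.range), Ideal.mem_span_singleton_self _, by simp⟩
    intro h2
    have h3 := (ValuationSubring.mem_nonunits_iff_exists_mem_maximalIdeal).1 h1
    obtain ⟨h4, h5⟩ := h3
    refine h5 ?_
    convert h2
    simp

section Period

theorem sum_units_eq_sum_range {F M : Type*} [Field F] [Fintype F] [AddCommMonoid M] {γ : Fˣ}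
    (hγ : orderOf γ = Fintype.card F - 1) (g : Fˣ → M) :
    ∑ x, g x = ∑ n ∈ Finset.range (Fintype.card F - 1), g (γ ^ n) := by
  have hinj : Set.InjOn (fun n => γ ^ n) (Finset.range (Fintype.card F - 1)) := by
    rw [← hγ, Finset.coe_range]
    exact pow_injOn_Iio_orderOf
  rw [← Finset.sum_image (f := g) hinj]
  congr 1
  symm
  refine Finset.eq_univ_of_card _ ?_
  rw [Finset.card_image_of_injOn hinj, Finset.card_range, Fintype.card_units]

variable {F R : Type*} [Field F] [CommRing R]

/-- The `a`-th Gaussian period `∑_{t < M} ψ (γ ^ (a + N t))`. -/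
def gaussPeriod (ψ : AddChar F R) (γ : Fˣ) (N M a : ℕ) : R :=
  ∑ t ∈ Finset.range M, ψ ((γ : F) ^ (a + N * t))

theorem pow_mul_eq_one [Fintype F] {γ : Fˣ} {N M : ℕ} (hM : Fintype.card F - 1 = M * N) :
    (γ : F) ^ (N * M) = 1 := by
  rw [mul_comm, ← hM]
  exact FiniteField.pow_card_sub_one_eq_one _ γ.ne_zero

variable [Fintype F] (ψ : AddChar F R) {γ : Fˣ} {N M : ℕ} (hM : Fintype.card F - 1 = M * N)

include hM in
theorem gaussPeriod_add (a : ℕ) : gaussPeriod ψ γ N M (a + N) = gaussPeriod ψ γ N M a := by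
  have h1 := Finset.sum_range_succ (fun t => ψ ((γ : F) ^ (a + N * t))) M
  rw [Finset.sum_range_succ'] at h1
  rw [mul_zero, pow_add _ a (N * M), pow_mul_eq_one hM, mul_one, add_zero] at h1
  rw [gaussPeriod, gaussPeriod, ← add_right_cancel h1]
  refine Finset.sum_congr rfl fun t _ => ?_
  congr 2
  ring

include hM in
theorem natCast_mul_gaussPeriod (hγ : orderOf γ = Fintype.card F - 1) (a : ℕ) :
    (N : R) * gaussPeriod ψ γ N M a = ∑ x : Fˣ, ψ ((γ : F) ^ a * (x : F) ^ N) := by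
  rw [sum_units_eq_sum_range hγ (fun x : Fˣ => ψ ((γ : F) ^ a * (x : F) ^ N)), hM,
    sum_range_mul_eq, gaussPeriod, Finset.mul_sum]
  refine Finset.sum_congr rfl fun t _ => ?_
  have : ∀ s, ψ ((γ : F) ^ a * ((γ ^ (t + M * s) : Fˣ) : F) ^ N) = ψ ((γ : F) ^ (a + N * t)) := by
    intro s
    rw [Units.val_pow_eq_pow_val, ← pow_mul, ← pow_add,
      show a + (t + M * s) * N = a + N * t + N * M * s by ring, pow_add _ (a + N * t),
      pow_mul _ (N * M), pow_mul_eq_one hM, one_pow, mul_one]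
  rw [Finset.sum_congr rfl fun s _ => this s, Finset.sum_const, Finset.card_range, nsmul_eq_mul]

include hM in
theorem gaussSum_eq_sum_gaussPeriod (hγ : orderOf γ = Fintype.card F - 1) {χ : MulChar F R}
    (hχ : χ γ ^ N = 1) :
    gaussSum χ ψ = ∑ a ∈ Finset.range N, χ γ ^ a * gaussPeriod ψ γ N M a := by
  have h1 : gaussSum χ ψ = ∑ x : Fˣ, χ x * ψ x := by
    rw [sum_units_eq_sub fun x : F => χ x * ψ x, χ.map_nonunit not_isUnit_zero, zero_mul,
      sub_zero, gaussSum]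
  rw [h1, sum_units_eq_sum_range hγ (fun x : Fˣ => χ x * ψ x), hM, mul_comm, sum_range_mul_eq]
  refine Finset.sum_congr rfl fun a _ => ?_
  rw [gaussPeriod, Finset.mul_sum]
  refine Finset.sum_congr rfl fun t _ => ?_
  rw [Units.val_pow_eq_pow_val, map_pow, pow_add (χ γ), pow_mul (χ γ), hχ, one_pow, mul_one]

variable [IsDomain R] [CharZero R] {p : ℕ} [Fact p.Prime] [CharP F p] [Algebra (ZMod p) F]

include hM in
theorem gaussPeriod_mul (hN : N ≠ 0) (hγ : orderOf γ = Fintype.card F - 1) {ζ : R}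
    (hζ : ζ ^ p = 1) (a : ℕ) :
    gaussPeriod (traceChar F hζ) γ N M (p * a) = gaussPeriod (traceChar F hζ) γ N M a := by
  refine mul_left_cancel₀ (Nat.cast_ne_zero.2 hN) ?_
  rw [natCast_mul_gaussPeriod _ hM hγ, natCast_mul_gaussPeriod _ hM hγ]
  symm
  have hinj : Function.Injective fun x : Fˣ => x ^ p := fun x y h =>
    Units.ext (frobenius_inj F p (by simpa [frobenius_def] using congrArg Units.val h))
  refine Fintype.sum_bijective _ (Finite.injective_iff_bijective.1 hinj) _ _ fun x => ?_
  rw [← traceChar_pow hζ]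
  congr 1
  rw [Units.val_pow_eq_pow_val]
  ring

omit [IsDomain R] [CharZero R] in
theorem exists_eq_intCast_of_injective {K : Type*} [Field K] [CharZero K] {f : R →+* K}
    (hf : Function.Injective f) {x : R} (hx : IsIntegral ℤ x) {m z : ℤ} (hm : m ≠ 0)
    (h : (m : R) * x = z) : ∃ w : ℤ, x = w := by
  have h1 : f x = algebraMap ℚ K (z / m) := by
    have hm' : (m : K) ≠ 0 := Int.cast_ne_zero.2 hm
    rw [map_div₀, map_intCast, map_intCast, eq_div_iff hm', mul_comm]
    simpa using congrArg f h
  have h2 := hx.map f.toIntAlgHom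
  change IsIntegral ℤ (f x) at h2
  rw [h1, isIntegral_algebraMap_iff (algebraMap ℚ K).injective] at h2
  obtain ⟨w, hw⟩ := IsIntegrallyClosed.isIntegral_iff.1 h2
  refine ⟨w, hf ?_⟩
  rw [h1, ← hw]
  simp

theorem exists_eq_intCast_of_isIntegral {x : R} (hx : IsIntegral ℤ x) {m z : ℤ} (hm : m ≠ 0)
    (h : (m : R) * x = z) : ∃ w : ℤ, x = w := by
  have hinj := IsFractionRing.injective R (FractionRing R)
  have : CharZero (FractionRing R) := charZero_of_injective_algebraMap hinj
  exact exists_eq_intCast_of_injective hinj hx hm h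

omit [CharP F p] in
include hM in
theorem exists_gaussPeriod_eq_intCast (hN : N ≠ 0) (hNp : N.Coprime (p - 1))
    (hγ : orderOf γ = Fintype.card F - 1) {ζ : R} (hζ : IsPrimitiveRoot ζ p) (a : ℕ) :
    ∃ w : ℤ, gaussPeriod (traceChar F hζ.pow_eq_one) γ N M a = w := by
  have hp : p.Prime := Fact.out
  set ψ := traceChar F hζ.pow_eq_one with hψ
  have hint : IsIntegral ℤ (gaussPeriod ψ γ N M a) := by
    refine IsIntegral.sum _ fun t _ => ?_
    refine IsIntegral.of_pow hp.pos ?_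
    rw [hψ, traceChar_apply, ← pow_mul, mul_comm, pow_mul, hζ.pow_eq_one, one_pow]
    exact isIntegral_one
  have hsum : ∀ y : F, ∃ w : ℤ, ∑ u : (ZMod p)ˣ, ψ (algebraMap (ZMod p) F u * y) = w := by
    intro y
    set φ : AddChar (ZMod p) R := ψ.compAddMonoidHom
      ((AddMonoidHom.mulRight y).comp (algebraMap (ZMod p) F).toAddMonoidHom) with hφ
    have h1 : ∑ u : (ZMod p)ˣ, ψ (algebraMap (ZMod p) F u * y) = ∑ u : ZMod p, φ u - 1 := by
      rw [← AddChar.map_zero_eq_one φ, ← sum_units_eq_sub fun x => φ x]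
      rfl
    rw [h1, AddChar.sum_eq_ite]
    split_ifs
    · exact ⟨p - 1, by simp⟩
    · exact ⟨-1, by simp⟩
  choose w hw using hsum
  have hmul : (((p - 1 : ℕ) * N : ℤ) : R) * gaussPeriod ψ γ N M a =
      ((∑ x : Fˣ, w ((γ : F) ^ a * (x : F) ^ N) : ℤ) : R) := by
    push_cast
    simp_rw [← hw]
    rw [mul_assoc, natCast_mul_gaussPeriod _ hM hγ, Finset.sum_comm]
    have h1 : ∀ u : (ZMod p)ˣ,
        ∑ x : Fˣ, ψ (algebraMap (ZMod p) F u * ((γ : F) ^ a * (x : F) ^ N)) =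
        ∑ x : Fˣ, ψ ((γ : F) ^ a * (x : F) ^ N) := by
      intro u
      have hc : (Nat.card (ZMod p)ˣ).Coprime N := by
        rw [Nat.card_eq_fintype_card, ZMod.card_units]
        exact hNp.symm
      obtain ⟨v, rfl⟩ := (powCoprime hc).surjective u
      refine Fintype.sum_bijective (fun x : Fˣ => Units.map (algebraMap (ZMod p) F) v * x)
        (Group.mulLeft_bijective _) _ _ fun x => ?_
      congr 1
      simp
      ring
    rw [Finset.sum_congr rfl fun u _ => h1 u, Finset.sum_const, Finset.card_univ, ZMod.card_units,
      nsmul_eq_mul]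
  refine exists_eq_intCast_of_isIntegral hint (m := (p - 1 : ℕ) * N) ?_ hmul
  exact_mod_cast mul_ne_zero (Nat.sub_ne_zero_of_lt hp.one_lt) hN

end Period

section QuadraticPeriod

variable {R : Type*} [CommRing R] [IsDomain R]

theorem pow_dvd_of_intCast_pow_dvd [CharZero R] {p : ℕ} (hp : p.Prime) (hu : ¬ IsUnit (p : R))
    {e : ℕ} {z : ℤ} (h : (p : R) ^ e ∣ z) : (p : ℤ) ^ e ∣ z := by
  induction e generalizing z with
  | zero => simp
  | succ e ih =>
    have h1 : (p : ℤ) ∣ z := by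
      by_contra hz
      obtain ⟨a, b, hab⟩ := (Nat.prime_iff_prime_int.1 hp).coprime_iff_not_dvd.2 hz
      refine hu (isUnit_of_dvd_one ?_)
      have h2 : (a : R) * p + b * z = 1 := by exact_mod_cast congrArg (Int.cast : ℤ → R) hab
      rw [← h2]
      exact dvd_add (dvd_mul_left _ _)
        (((dvd_pow_self _ e.succ_ne_zero).trans h).mul_left _)
    obtain ⟨w, rfl⟩ := h1
    rw [pow_succ']
    refine mul_dvd_mul_left _ (ih ?_)
    rw [pow_succ', Int.cast_mul, Int.cast_natCast] at h
    exact (mul_dvd_mul_iff_left (Nat.cast_ne_zero.2 hp.ne_zero)).1 h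

theorem eq_or_eq_neg_of_sq_add {e : ℕ} {b c : ℤ} (h : b ^ 2 + 163 * c ^ 2 = 4 * 41 ^ (2 * e + 1))
    (hb : 41 ^ e ∣ b) (hc : 41 ^ e ∣ c) : b = c ∨ b = -c := by
  obtain ⟨x, rfl⟩ := hb
  obtain ⟨y, rfl⟩ := hc
  have h1 : x ^ 2 + 163 * y ^ 2 = 164 := by
    refine mul_left_cancel₀ (pow_ne_zero (2 * e) (by norm_num : (41 : ℤ) ≠ 0)) ?_
    linear_combination h
  have h2 : x = y ∨ x = -y := by
    rw [← sq_eq_sq_iff_eq_or_eq_neg]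
    have hy1 : y ≤ 1 := by nlinarith
    have hy2 : -1 ≤ y := by nlinarith
    have hx1 : x ≤ 13 := by nlinarith
    have hx2 : -13 ≤ x := by nlinarith
    interval_cases y <;> interval_cases x <;> simp_all
  rcases h2 with rfl | rfl
  · simp
  · simp

theorem eq_or_eq_neg_of_dvd [CharZero R] (hu : ¬ IsUnit (41 : R)) {e : ℕ} {b c : ℤ} {g G G' : R}
    (hG : 2 * G = b + c * g) (hG' : 2 * G' = b - c * g) (hg : g ^ 2 = -163)
    (hGG : G * G' = 41 ^ (2 * e + 1)) (h : G ∣ 41 ^ (e + 1)) (h' : G' ∣ 41 ^ (e + 1)) :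
    b = c ∨ b = -c := by
  have key : ∀ {x y : R}, x * y = 41 ^ (2 * e + 1) → y ∣ 41 ^ (e + 1) → (41 : R) ^ e ∣ x := by
    rintro x y hxy ⟨w, hw⟩
    have hy : y ≠ 0 := by
      rintro rfl
      rw [mul_zero] at hxy
      exact pow_ne_zero _ (by norm_num) hxy.symm
    refine ⟨w, mul_right_cancel₀ hy ?_⟩
    rw [hxy, mul_assoc, mul_comm w, ← hw, ← pow_add]
    congr 1
    ring
  have h1 := key hGG h'
  have h2 := key ((mul_comm _ _).trans hGG) h
  have hp : Nat.Prime 41 := by norm_num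
  have hu' : ¬ IsUnit ((41 : ℕ) : R) := by exact_mod_cast hu
  refine eq_or_eq_neg_of_sq_add (e := e) ?_ ?_ ?_
  · have h3 : (b : R) ^ 2 + 163 * c ^ 2 = 4 * 41 ^ (2 * e + 1) := by
      rw [← hGG]
      linear_combination (c : R) ^ 2 * hg - 2 * G' * hG - (b + c * g) * hG'
    exact_mod_cast h3
  · have h3 : (b : R) = G + G' := by
      refine mul_left_cancel₀ (two_ne_zero' R) ?_
      linear_combination -hG - hG'
    have h4 := pow_dvd_of_intCast_pow_dvd hp hu' (e := e) (z := b)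
      (by rw [h3]; exact_mod_cast dvd_add h1 h2)
    exact_mod_cast h4
  · have h3 : ((163 * c : ℤ) : R) = (G' - G) * g := by
      refine mul_left_cancel₀ (two_ne_zero' R) ?_
      push_cast
      linear_combination 2 * c * hg + g * hG - g * hG'
    have h4 := pow_dvd_of_intCast_pow_dvd hp hu' (e := e) (z := 163 * c)
      (by rw [h3]; exact_mod_cast (dvd_sub h2 h1).mul_right _)
    refine IsCoprime.dvd_of_dvd_mul_left (y := 163) (IsCoprime.pow_left ?_) (by exact_mod_cast h4)
    rw [Int.isCoprime_iff_gcd_eq_one]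
    norm_num

variable {n : ℕ} {f : ℕ → R} (hN : ∀ a, f (a + 163 ^ (n + 1)) = f a) (hp : ∀ a, f (41 * a) = f a)

include hN hp in
theorem sum_pow_mul_eq {ξ : R} (hξ : IsPrimitiveRoot ξ (163 ^ (n + 1))) :
    ∑ a ∈ Finset.range (163 ^ (n + 1)), ξ ^ a * f a =
      ∑ y ∈ Finset.range 163, (ξ ^ 163 ^ n) ^ y * f (163 ^ n * y) := by
  have hξ' : IsPrimitiveRoot (ξ ^ 163 ^ n) 163 := hξ.pow (by positivity) (pow_succ _ _)
  rw [pow_succ, sum_range_mul_eq, Finset.sum_eq_single 0]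
  · refine Finset.sum_congr rfl fun y _ => ?_
    rw [zero_add, pow_mul]
  · intro i hi hi0
    have hi' : ¬ 163 ^ n ∣ i := fun h =>
      hi0 (Nat.eq_zero_of_dvd_of_lt h (Finset.mem_range.1 hi))
    have h1 : ∀ y, f (i + 163 ^ n * y) = f i := by
      intro y
      induction y with
      | zero => simp
      | succ y ih =>
        rw [Nat.mul_succ, ← add_assoc, eq_add_of_not_dvd hN hp, ih]
        rwa [Nat.dvd_add_left (dvd_mul_right _ _)]
    have h2 : ∀ y ∈ Finset.range 163, ξ ^ (i + 163 ^ n * y) * f (i + 163 ^ n * y) =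
        ξ ^ i * f i * (ξ ^ 163 ^ n) ^ y := by
      intro y _
      rw [h1, pow_add, pow_mul]
      ring
    rw [Finset.sum_congr rfl h2, ← Finset.mul_sum, hξ'.geom_sum_eq_zero (by norm_num), mul_zero]
  · simp

instance fact_prime_oneHundredSixtyThree : Fact (Nat.Prime 163) := ⟨by norm_num⟩

variable (R) in
/-- The quadratic character modulo `163` with values in `R`. -/
def quadChar : MulChar (ZMod 163) R := (quadraticChar (ZMod 163)).ringHomComp (Int.castRingHom R)

omit [IsDomain R] in
theorem quadChar_natCast {y : ℕ} (hy : ¬ 163 ∣ y) :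
    quadChar R (y : ZMod 163) = if y ^ 81 % 163 = 1 then 1 else -1 := by
  have hy0 : (y : ZMod 163) ≠ 0 := by rwa [Ne, ZMod.natCast_eq_zero_iff]
  have h1 := quadraticChar_eq_pow_of_char_ne_two' (F := ZMod 163)
    (by rw [ZMod.ringChar_zmod_n]; norm_num) (y : ZMod 163)
  rw [ZMod.card, show 163 / 2 = 81 from rfl] at h1
  have h2 : quadraticChar (ZMod 163) y = if y ^ 81 % 163 = 1 then 1 else -1 := by
    have h3 : ((y ^ 81 % 163 : ℕ) : ZMod 163) = y ^ 81 := by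
      rw [ZMod.natCast_mod]; push_cast; rfl
    rw [← h3] at h1
    have h4 := quadraticChar_dichotomy hy0
    rcases pow_eightyOne_mod y hy with h | h <;> rcases h4 with h5 | h5 <;>
      rw [h, h5] at h1 <;> first | (simp [h, h5]; done) | (exfalso; revert h1; decide)
  rw [quadChar, MulChar.ringHomComp_apply, h2]
  split_ifs <;> simp

omit [IsDomain R] in
theorem quadChar_neg_one : quadChar R (-1) = -1 := by
  have := quadChar_natCast (R := R) (y := 162) (by norm_num)
  rwa [if_neg (by norm_num), show ((162 : ℕ) : ZMod 163) = -1 by decide] at this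

theorem gaussSum_quadChar_sq [CharZero R] {ψ : AddChar (ZMod 163) R} (hψ : ψ.IsPrimitive) :
    gaussSum (quadChar R) ψ ^ 2 = -163 := by
  have h1 := quadChar_neg_one (R := R)
  have h2 : quadChar R ≠ 1 := by
    intro h
    rw [h, MulChar.one_apply (isUnit_one.neg)] at h1
    norm_num at h1
  rw [gaussSum_sq h2 ((quadraticChar_isQuadratic _).comp _) hψ, h1, ZMod.card]
  norm_num

include hN hp in
theorem two_mul_sum_pow_mul_eq {ε : R} (hε : IsPrimitiveRoot ε 163) :
    2 * ∑ y ∈ Finset.range 163, ε ^ y * f (163 ^ n * y) =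
      (2 * f 0 - f (163 ^ n) - f (163 ^ n * 162)) +
      (f (163 ^ n) - f (163 ^ n * 162)) *
        gaussSum (quadChar R) (AddChar.zmodChar 163 hε.pow_eq_one) := by
  have h1 : gaussSum (quadChar R) (AddChar.zmodChar 163 hε.pow_eq_one) =
      ∑ y ∈ Finset.range 163, quadChar R (y : ZMod 163) * ε ^ y := by
    rw [gaussSum]
    refine Finset.sum_nbij' (fun x => x.val) (fun y => (y : ZMod 163)) ?_ ?_ ?_ ?_ ?_
    · intro x _; exact Finset.mem_range.2 x.val_lt
    · simp
    · intro x _; exact ZMod.natCast_zmod_val x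
    · intro y hy; exact ZMod.val_cast_of_lt (Finset.mem_range.1 hy)
    · intro x _; rw [AddChar.zmodChar_apply, ZMod.natCast_zmod_val]
  have h2 := hε.geom_sum_eq_zero (by norm_num)
  have h3 : ∀ y ∈ Finset.range 163, 2 * (ε ^ y * f (163 ^ n * y)) =
      (if y = 0 then 2 * f 0 - f (163 ^ n) - f (163 ^ n * 162) else 0) +
      (f (163 ^ n) + f (163 ^ n * 162)) * ε ^ y +
      (f (163 ^ n) - f (163 ^ n * 162)) * (quadChar R (y : ZMod 163) * ε ^ y) := by
    intro y hy
    split_ifs with hy0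
    · subst hy0
      rw [Nat.cast_zero, MulChar.map_zero]
      simp
    · have hy' : ¬ 163 ∣ y := fun h => hy0 (Nat.eq_zero_of_dvd_of_lt h (Finset.mem_range.1 hy))
      rw [quadChar_natCast hy']
      split_ifs with h
      · rw [eq_of_pow_modEq hN hp hy' (z := 1) (by rw [Nat.ModEq, h]; norm_num), mul_one]
        ring
      · have h4 := (pow_eightyOne_mod y hy').resolve_left h
        rw [eq_of_pow_modEq hN hp hy' (z := 162) (by rw [Nat.ModEq, h4]; norm_num)]
        ring
  rw [Finset.mul_sum, Finset.sum_congr rfl h3, Finset.sum_add_distrib, Finset.sum_add_distrib,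
    ← Finset.mul_sum, ← Finset.mul_sum, h2, ← h1, Finset.sum_ite_eq']
  simp

omit [IsDomain R] in
theorem gaussSum_quadChar_of_mul_eq_one {ε ε' : R} (hε : ε ^ 163 = 1) (hε' : ε' ^ 163 = 1)
    (h : ε * ε' = 1) :
    gaussSum (quadChar R) (AddChar.zmodChar 163 hε') =
      -gaussSum (quadChar R) (AddChar.zmodChar 163 hε) := by
  have h1 : AddChar.zmodChar 163 hε' = (AddChar.zmodChar 163 hε)⁻¹ := by
    refine eq_inv_of_mul_eq_one_right ?_
    ext x
    rw [AddChar.mul_apply, AddChar.zmodChar_apply, AddChar.zmodChar_apply, ← mul_pow, h, one_pow,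
      AddChar.one_apply]
  have h3 := mul_gaussSum_inv_eq_gaussSum (quadChar R) (AddChar.zmodChar 163 hε)
  rw [h1, ← h3, quadChar_neg_one]
  ring

end QuadraticPeriod

section Main

theorem charP_fortyOne {F : Type*} [Field F] [Fintype F] {f : ℕ}
    (hF : Fintype.card F = 41 ^ f) : CharP F 41 := by
  have : Fact (Nat.Prime 41) := ⟨by norm_num⟩
  exact charP_of_card_eq_prime_pow hF

theorem exists_card_sub_one_eq {F : Type*} [Fintype F] {n : ℕ}
    (hF : Fintype.card F = 41 ^ (81 * 163 ^ n)) :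
    ∃ M, M ≠ 0 ∧ Fintype.card F - 1 = M * 163 ^ (n + 1) := by
  have h1 : 1 < 41 ^ (81 * 163 ^ n) := Nat.one_lt_pow (by positivity) (by norm_num)
  have h2 : 163 ^ (n + 1) ∣ 41 ^ (81 * 163 ^ n) - 1 := by
    rw [← ZMod.natCast_eq_zero_iff, Nat.cast_sub h1.le, sub_eq_zero, ← orderOf_fortyOne]
    push_cast
    exact pow_orderOf_eq_one _
  obtain ⟨M, hM⟩ := h2
  refine ⟨M, ?_, by rw [hF, hM, mul_comm]⟩
  rintro rfl
  omega

/-- The Gauss sums of the characters `ω⁻¹ ^ (M * j)` for `j = ±1` divide `41 ^ (e + 1)`. -/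
theorem gaussSum_dvd_fortyOne_pow {F R : Type*} [Field F] [Fintype F] [Fact (Nat.Prime 41)]
    [CharP F 41] [Algebra (ZMod 41) F] [CommRing R] [IsDomain R] {n M e j c : ℕ}
    (hM : 41 ^ (81 * 163 ^ n) = M * 163 ^ (n + 1) + 1) (he : 81 * 163 ^ n = 2 * e + 1) {ζ : R}
    (hζ : IsPrimitiveRoot ζ 41) {χ : MulChar F R}
    (hχ : gaussSum χ (traceChar F hζ.pow_eq_one) ∣ ζ - 1)
    (hc : c = 1 ∨ c = 162) (hj : j ^ 81 % 163 = c) (hjN : j < 163 ^ (n + 1)) :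
    gaussSum (χ ^ (M * j)) (traceChar F hζ.pow_eq_one) ∣ 41 ^ (e + 1) := by
  have h1 := gaussSum_inv_pow_dvd hζ hχ hjN (81 * 163 ^ n)
  have h2 : 41 ^ (81 * 163 ^ n) * j / 163 ^ (n + 1) = M * j := by
    rw [hM, show (M * 163 ^ (n + 1) + 1) * j = j + 163 ^ (n + 1) * (M * j) by ring,
      Nat.add_mul_div_left _ _ (by positivity), Nat.div_eq_of_lt hjN, zero_add]
  rw [h2] at h1
  refine h1.trans ((pow_dvd_pow _ (forty_mul_sum_le n c j hc hj)).trans ?_)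
  rw [he, show 20 * (2 * e + 1 + 1) = 40 * (e + 1) by ring, pow_mul]
  exact pow_dvd_pow_of_dvd (by exact_mod_cast sub_one_pow_dvd hζ) _

theorem exists_gaussPeriod_eq {n : ℕ} {F : Type} [Field F] [Fintype F]
    (hF : Fintype.card F = 41 ^ (81 * 163 ^ n)) {γ : Fˣ} (hγ : orderOf γ = Fintype.card F - 1)
    {M : ℕ} (hM : Fintype.card F - 1 = M * 163 ^ (n + 1)) :
    ∃ (R : Type) (_ : CommRing R) (_ : IsDomain R) (_ : CharZero R) (ψ : AddChar F R),
      ψ.IsPrimitive ∧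
      (∀ a, gaussPeriod ψ γ (163 ^ (n + 1)) M (a + 163 ^ (n + 1)) =
        gaussPeriod ψ γ (163 ^ (n + 1)) M a) ∧
      (∀ a, gaussPeriod ψ γ (163 ^ (n + 1)) M (41 * a) =
        gaussPeriod ψ γ (163 ^ (n + 1)) M a) ∧
      (gaussPeriod ψ γ (163 ^ (n + 1)) M 0 = gaussPeriod ψ γ (163 ^ (n + 1)) M (163 ^ n) ∨
        gaussPeriod ψ γ (163 ^ (n + 1)) M 0 =
          gaussPeriod ψ γ (163 ^ (n + 1)) M (163 ^ n * 162)) := by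
  have : Fact (Nat.Prime 41) := ⟨by norm_num⟩
  have : CharP F 41 := charP_fortyOne hF
  let _ : Algebra (ZMod 41) F := ZMod.algebra F 41
  obtain ⟨R, _, _, _, _, τ, ζ, hζ, hu⟩ := exists_isLocalRing_wittVector 41 F
  have hN0 : 163 ^ (n + 1) ≠ 0 := by positivity
  have hodd : Odd (81 * 163 ^ n) := Odd.mul (by decide) (Odd.pow (by decide))
  obtain ⟨e, he⟩ := hodd
  have hcard : 41 ≤ Fintype.card F := by
    rw [hF]
    exact Nat.le_self_pow (by positivity) _
  have hper := gaussPeriod_add (traceChar F hζ.pow_eq_one) (γ := γ) hM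
  have hfrob := gaussPeriod_mul hM hN0 hγ hζ.pow_eq_one
  refine ⟨R, inferInstance, inferInstance, inferInstance, traceChar F hζ.pow_eq_one,
    traceChar_isPrimitive hζ, hper, hfrob, ?_⟩
  have hint := exists_gaussPeriod_eq_intCast hM hN0 (Nat.Coprime.pow_left _ (by norm_num)) hγ hζ
  set ψ := traceChar F hζ.pow_eq_one with hψ
  set η := gaussPeriod ψ γ (163 ^ (n + 1)) M with hη
  set ω := teichmullerChar τ with hω
  set χ := ω⁻¹ ^ M with hχ
  have hω_pow : ω⁻¹ ^ (M * 163 ^ (n + 1)) = 1 := by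
    rw [← hM, ← Fintype.card_units]
    exact MulChar.pow_card_eq_one _
  have hdvd := gaussSum_teichmullerChar_inv_dvd τ (by omega) hζ hu
  have hM' : 41 ^ (81 * 163 ^ n) = M * 163 ^ (n + 1) + 1 := by omega
  have hdvd1 : gaussSum χ ψ ∣ 41 ^ (e + 1) := by
    have := gaussSum_dvd_fortyOne_pow hM' he hζ hdvd (j := 1) (.inl rfl) (by norm_num)
      (Nat.one_lt_pow (by positivity) (by norm_num))
    rwa [mul_one] at this
  have hdvd2 : gaussSum χ⁻¹ ψ ∣ 41 ^ (e + 1) := by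
    have hj : (163 ^ (n + 1) - 1) ^ 81 % 163 = 162 := by
      have h1 : 163 ^ (n + 1) - 1 = 162 + 163 * (163 ^ n - 1) := by
        have := Nat.one_le_pow n 163 (by norm_num)
        rw [pow_succ]
        omega
      rw [h1, Nat.pow_mod, Nat.add_mul_mod_self_left]
    have := gaussSum_dvd_fortyOne_pow hM' he hζ hdvd (.inr rfl) hj (by omega)
    convert this using 2
    refine inv_eq_of_mul_eq_one_right ?_
    rw [hχ, ← pow_add, ← hω_pow]
    congr 1
    have : 163 ^ (n + 1) = 163 ^ (n + 1) - 1 + 1 := by omega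
    nth_rw 2 [this]
    ring
  have hprim : IsPrimitiveRoot (χ γ) (163 ^ (n + 1)) := by
    have h1 : χ γ = (ω (γ⁻¹ : Fˣ)) ^ M := by
      rw [hχ, MulChar.pow_apply_coe, MulChar.inv_apply', Units.val_inv_eq_inv_val]
    rw [h1]
    refine (isPrimitiveRoot_teichmullerChar_apply τ γ⁻¹).pow (orderOf_pos _) ?_
    rw [orderOf_inv, hγ, hM]
  have hmul : χ γ * χ⁻¹ γ = 1 := by
    rw [← MulChar.mul_apply, mul_inv_cancel, MulChar.one_apply γ.isUnit]
  have hprim' : IsPrimitiveRoot (χ⁻¹ γ) (163 ^ (n + 1)) := by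
    have h1 : χ⁻¹ γ = (ω γ) ^ M := by
      rw [hχ, inv_pow, inv_inv, MulChar.pow_apply_coe]
    rw [h1]
    refine (isPrimitiveRoot_teichmullerChar_apply τ γ).pow (orderOf_pos _) ?_
    rw [hγ, hM]
  have hχ1 : χ ≠ 1 := by
    intro h
    rw [h, MulChar.one_apply γ.isUnit] at hprim
    have := hprim.eq_orderOf
    rw [orderOf_one] at this
    exact (Nat.one_lt_pow n.succ_ne_zero (by norm_num : 1 < 163)).ne' this
  have hneg : χ (-1) = 1 := by
    refine MulChar.val_neg_one_eq_one_of_odd_order (n := 163 ^ (n + 1)) (Odd.pow (by decide)) ?_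
    rw [hχ, ← pow_mul, hω_pow]
  have hprod : gaussSum χ ψ * gaussSum χ⁻¹ ψ = 41 ^ (2 * e + 1) := by
    have h1 := gaussSum_mul_gaussSum_eq_card hχ1 (traceChar_isPrimitive hζ)
    have h2 := mul_gaussSum_inv_eq_gaussSum χ⁻¹ ψ
    rw [MulChar.inv_apply', inv_neg, inv_one, hneg, one_mul] at h2
    rw [← hψ, h2, hF, he] at h1
    exact_mod_cast h1
  have hε := hprim.pow hN0.bot_lt (pow_succ 163 n)
  have hε' := hprim'.pow hN0.bot_lt (pow_succ 163 n)
  have hG := two_mul_sum_pow_mul_eq hper hfrob hε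
  have hG' := two_mul_sum_pow_mul_eq hper hfrob hε'
  rw [← sum_pow_mul_eq hper hfrob hprim, ← gaussSum_eq_sum_gaussPeriod ψ hM hγ hprim.pow_eq_one]
    at hG
  rw [← sum_pow_mul_eq hper hfrob hprim', ← gaussSum_eq_sum_gaussPeriod ψ hM hγ hprim'.pow_eq_one,
    gaussSum_quadChar_of_mul_eq_one hε.pow_eq_one hε'.pow_eq_one
      (by rw [← mul_pow, hmul, one_pow])] at hG'
  choose w hw using hint
  simp only [hw] at hG hG' ⊢
  have hg := gaussSum_quadChar_sq (AddChar.zmodChar_primitive_of_primitive_root 163 hε)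
  have key := eq_or_eq_neg_of_dvd (b := 2 * w 0 - w (163 ^ n) - w (163 ^ n * 162))
    (c := w (163 ^ n) - w (163 ^ n * 162)) (by exact_mod_cast hu) (by exact_mod_cast hG)
    (by push_cast; rw [hG']; ring) hg hprod hdvd1 hdvd2
  norm_cast
  omega

end Main

section ClassUnion

variable {F : Type*} [Field F]

/-- The union of the cyclotomic classes `C_b, …, C_{b + P - 1}` of order `N`, where
`M = |C_0|`. -/
def classUnion (γ : Fˣ) (N M P b : ℕ) : Finset F :=
  (Finset.range P ×ˢ Finset.range M).image fun x => (γ : F) ^ (x.1 + b + N * x.2)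

theorem zero_notMem_classUnion (γ : Fˣ) (N M P b : ℕ) : (0 : F) ∉ classUnion γ N M P b := by
  rw [classUnion, Finset.mem_image]
  rintro ⟨x, -, hx⟩
  exact pow_ne_zero _ γ.ne_zero hx

variable [Fintype F] {γ : Fˣ} {N M P : ℕ}
  (hM : Fintype.card F - 1 = M * N)

include hM in
theorem mem_classUnion_iff (hM0 : M ≠ 0) {b : ℕ} {x : F} :
    x ∈ classUnion γ N M P b ↔ ∃ i < P, ∃ t : ℕ, x = (γ : F) ^ (i + b + N * t) := by
  rw [classUnion, Finset.mem_image]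
  constructor
  · rintro ⟨⟨i, t⟩, hit, rfl⟩
    rw [Finset.mem_product, Finset.mem_range] at hit
    exact ⟨i, hit.1, t, rfl⟩
  · rintro ⟨i, hi, t, rfl⟩
    refine ⟨(i, t % M), Finset.mem_product.2 ⟨Finset.mem_range.2 hi,
      Finset.mem_range.2 (Nat.mod_lt _ (Nat.pos_of_ne_zero hM0))⟩, ?_⟩
    conv_rhs => rw [← Nat.mod_add_div t M, mul_add, ← mul_assoc, ← add_assoc, pow_add, pow_mul _ (N * M),
      pow_mul_eq_one hM, one_pow, mul_one]

variable (hγ : orderOf γ = Fintype.card F - 1) (hP : P ≤ N)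

include hM hγ hP in
theorem injOn_classUnion (b : ℕ) :
    Set.InjOn (fun x : ℕ × ℕ => (γ : F) ^ (x.1 + b + N * x.2))
      (Finset.range P ×ˢ Finset.range M : Finset (ℕ × ℕ)) := by
  rintro ⟨i, t⟩ hx ⟨j, s⟩ hy h
  rw [Finset.mem_coe, Finset.mem_product, Finset.mem_range, Finset.mem_range] at hx hy
  dsimp only at hx hy h
  have hlt : ∀ {i t}, i < P → t < M → i + N * t < orderOf γ := by
    intro i t hi ht
    rw [hγ, hM]
    calc i + N * t < N + N * t := by omega
      _ = (t + 1) * N := by ring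
      _ ≤ M * N := Nat.mul_le_mul_right _ ht
  have h1 : γ ^ (i + N * t) = γ ^ (j + N * s) := by
    refine mul_left_cancel (a := γ ^ b) (Units.ext ?_)
    rw [← pow_add, ← pow_add, Units.val_pow_eq_pow_val, Units.val_pow_eq_pow_val]
    convert h using 2 <;> ring
  have h2 := pow_injOn_Iio_orderOf (hlt hx.1 hx.2) (hlt hy.1 hy.2) h1
  have h3 : i = j := by
    have h4 := congrArg (· % N) h2
    simpa [Nat.mod_eq_of_lt (hx.1.trans_le hP), Nat.mod_eq_of_lt (hy.1.trans_le hP)] using h4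
  subst h3
  have h4 := Nat.eq_of_mul_eq_mul_left (by omega) (Nat.add_left_cancel h2)
  rw [h4]

include hM hγ hP in
theorem card_classUnion (b : ℕ) : (classUnion γ N M P b).card = P * M := by
  rw [classUnion, Finset.card_image_of_injOn (injOn_classUnion hM hγ hP b), Finset.card_product,
    Finset.card_range, Finset.card_range]

include hM hγ hP in
theorem sum_classUnion {R : Type*} [CommRing R] (ψ : AddChar F R) (a b : ℕ) :
    ∑ x ∈ classUnion γ N M P b, ψ ((γ : F) ^ a * x) =
      ∑ i ∈ Finset.range P, gaussPeriod ψ γ N M (a + b + i) := by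
  rw [classUnion, Finset.sum_image (injOn_classUnion hM hγ hP b), Finset.sum_product]
  refine Finset.sum_congr rfl fun i _ => Finset.sum_congr rfl fun t _ => ?_
  rw [← pow_add]
  congr 2
  ring

theorem exists_pow_eq (hγ : orderOf γ = Fintype.card F - 1) (u : Fˣ) : ∃ a : ℕ, γ ^ a = u := by
  have h : Subgroup.zpowers γ = ⊤ := by
    rw [← Subgroup.card_eq_iff_eq_top, Nat.card_zpowers, hγ, Nat.card_eq_fintype_card,
      Fintype.card_units]
  have h1 : u ∈ Subgroup.zpowers γ := h ▸ Subgroup.mem_top u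
  rwa [← mem_powers_iff_mem_zpowers] at h1

include hM hγ in
theorem neg_mem_classUnion (hM0 : M ≠ 0) (hN : Odd N) {b : ℕ} {x : F}
    (hx : x ∈ classUnion γ N M P b) : -x ∈ classUnion γ N M P b := by
  rw [mem_classUnion_iff hM hM0] at hx ⊢
  obtain ⟨i, hi, t, rfl⟩ := hx
  obtain ⟨s, hs⟩ := exists_pow_eq hγ (-1)
  have h1 : (γ : F) ^ (N * s) = -1 := by
    rw [mul_comm, pow_mul, ← Units.val_pow_eq_pow_val, hs, Units.val_neg, Units.val_one, hN.neg_one_pow]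
  refine ⟨i, hi, t + s, ?_⟩
  rw [mul_add, ← add_assoc, pow_add _ _ (N * s), h1, mul_neg_one]

end ClassUnion

/-- Each `Cay(F_q, D_k)` is a strongly regular graph of degree `(q-1)/163`,
where `q = 41^{81*163^(m-1)}`, `N = 163^m`. -/
theorem cayley_srg_example_19
    (m N q : ℕ) (hm : 1 ≤ m)
    (hN : N = 163 ^ m) (hq : q = 41 ^ (81 * 163 ^ (m - 1)))
    (F : Type) [Field F] [Fintype F] (hF : Fintype.card F = q)
    (γ : Fˣ) (hγ : orderOf γ = q - 1)
    (D : ℕ → Set F)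
    (hD : ∀ k, D k = {x : F | ∃ i < 163 ^ (m - 1), ∃ t : ℕ,
        x = ((γ : F)) ^ (i + k * 163 ^ (m - 1) + N * t)}) :
    ∀ k ≤ 162,
      SimpleGraph.fromRel (fun x y : F => x - y ∈ D k) ≠ ⊤ ∧
      SimpleGraph.fromRel (fun x y : F => x - y ∈ D k) ≠ ⊥ ∧
      ∃ l u : ℕ, (SimpleGraph.fromRel (fun x y : F => x - y ∈ D k)).IsSRGWith
        q ((q - 1) / 163) l u := by

  obtain ⟨n, rfl⟩ : ∃ n, m = n + 1 := ⟨m - 1, by omega⟩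
  rw [Nat.add_sub_cancel] at hq
  simp only [Nat.add_sub_cancel] at hD
  subst hN hq
  have hP : 163 ^ n ≤ 163 ^ (n + 1) := Nat.pow_le_pow_right (by norm_num) n.le_succ
  obtain ⟨M, hM0, hM⟩ := exists_card_sub_one_eq hF
  rw [← hF] at hγ ⊢
  have hcard : (Fintype.card F - 1) / 163 = 163 ^ n * M := by
    rw [hM, pow_succ, ← mul_assoc, Nat.mul_div_cancel _ (by norm_num), mul_comm]
  intro k _
  set S := classUnion γ (163 ^ (n + 1)) M (163 ^ n) (k * 163 ^ n) with hS
  have hDS : ∀ x, x ∈ D k ↔ x ∈ S := fun x => by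
    rw [hD, hS, mem_classUnion_iff hM hM0, Set.mem_ofPred_eq]
  simp only [hDS]
  have h0 : (0 : F) ∉ S := zero_notMem_classUnion _ _ _ _ _
  have hneg : ∀ x ∈ S, -x ∈ S := fun x =>
    neg_mem_classUnion hM hγ hM0 (Odd.pow (by decide))
  have hScard : S.card = 163 ^ n * M := card_classUnion hM hγ hP _
  have hSpos : 0 < 163 ^ n * M := Nat.mul_pos (by positivity) (Nat.pos_of_ne_zero hM0)
  refine ⟨fun h => ?_, fun h => ?_, ?_⟩
  · have h1 : Finset.univ.erase (0 : F) ⊆ S := by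
      intro x hx
      have h2 : (SimpleGraph.fromRel fun x y : F => x - y ∈ S).Adj x 0 := by
        rw [h]
        exact Finset.ne_of_mem_erase hx
      rw [SimpleGraph.fromRel_adj, sub_zero, zero_sub] at h2
      exact h2.2.elim id fun h3 => neg_neg x ▸ hneg _ h3
    have h2 := Finset.card_le_card h1
    rw [Finset.card_erase_of_mem (Finset.mem_univ _), Finset.card_univ, hM, hScard, pow_succ,
      ← mul_assoc, mul_comm M] at h2
    omega
  · obtain ⟨x, hx⟩ := Finset.card_pos.1 (hScard ▸ hSpos)
    have h2 : (SimpleGraph.fromRel fun x y : F => x - y ∈ S).Adj x 0 := by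
      rw [SimpleGraph.fromRel_adj, sub_zero]
      exact ⟨fun h3 => h0 (h3 ▸ hx), .inl hx⟩
    rw [h] at h2
    exact h2
  · obtain ⟨R, _, _, _, ψ, hψ, hper, hfrob, heq⟩ := exists_gaussPeriod_eq hF hγ hM
    set η := gaussPeriod ψ γ (163 ^ (n + 1)) M with hη
    have hval : ∀ y, η (163 ^ n * y) = η (163 ^ n) ∨ η (163 ^ n * y) = η (163 ^ n * 162) := by
      intro y
      by_cases hy : 163 ∣ y
      · obtain ⟨z, rfl⟩ := hy
        have h1 : η (163 ^ n * (163 * z)) = η 0 :=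
          eq_of_modEq_of_periodic hper (by
            rw [← mul_assoc, ← pow_succ]
            exact Nat.modEq_zero_iff_dvd.2 (dvd_mul_right _ _))
        rwa [h1]
      · rcases pow_eightyOne_mod y hy with h1 | h1
        · left
          rw [eq_of_pow_modEq hper hfrob hy (z := 1) (by rw [Nat.ModEq, h1]; norm_num), mul_one]
        · right
          rw [eq_of_pow_modEq hper hfrob hy (z := 162) (by rw [Nat.ModEq, h1]; norm_num)]
    rw [hcard, ← hScard]
    convert exists_isSRGWith_of_sum_addChar hψ S h0 hneg
      (∑ i ∈ Finset.range (163 ^ n), η i - η 0 + η (163 ^ n))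
      (∑ i ∈ Finset.range (163 ^ n), η i - η 0 + η (163 ^ n * 162)) ?_
    intro c hc
    obtain ⟨a, ha⟩ := exists_pow_eq hγ (Units.mk0 c hc)
    have ha' : c = (γ : F) ^ a := by
      rw [← Units.val_pow_eq_pow_val, ha, Units.val_mk0]
    obtain ⟨y, -, -, hy⟩ := exists_sum_window hper hfrob (a + k * 163 ^ n)
    rw [ha', sum_classUnion hM hγ hP, hy]
    exact (hval y).imp (fun h => by rw [h]) fun h => by rw [h]
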